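/- Let d ≥ 5 and let f ∈ K[s,t] be a nonzero homogeneous polynomial of degree d such that no nonzero homogeneous polynomial of degree 2 annihilates f, and such that g∘f = 0 for some nonzero homogeneous cubic g ∈ K[s,t] that is divisible by the square of a linear form (equivalently, the scheme-theoretic intersection of the projected curve π_p(C_d) with its trisecant line L contains a point of multiplicity at least two). Then for every K-basis h₁,…,h_d of W_f, the ideal J of K[z₁,…,z_d] generated by (ker φ_h)₂ is generated by homogeneous quadratic polynomials of rank at most 4 contained in J, but J is not generated by homogeneous quadratic polynomials of rank at most 3 contained in J. (In other words, the scheme X = π_p(C_d) ∪ L has rank index exactly 4.) -/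

import Mathlib

open MvPolynomial

/-- The apolarity action `G ∘ f = G(∂/∂s, ∂/∂t) f` for bivariate polynomials. -/
noncomputable def apolar {K : Type*} [CommSemiring K] (G f : MvPolynomial (Fin 2) K) :
    MvPolynomial (Fin 2) K :=
  ∑ a ∈ G.support, G.coeff a • ((⇑(pderiv (0 : Fin 2)))^[a 0] ((⇑(pderiv (1 : Fin 2)))^[a 1] f))

/-- A polynomial `q` has rank at most `k` as a quadric: it is a sum of `k` squares of
linear forms. -/
def rankLE {K : Type*} [CommSemiring K] {σ : Type*} (k : ℕ) (q : MvPolynomial σ K) : Prop :=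
  ∃ ℓ : Fin k → MvPolynomial σ K, (∀ i, (ℓ i).IsHomogeneous 1) ∧ q = ∑ i, (ℓ i) ^ 2

section core

variable {K : Type*} [Field K]

lemma rankLE_four [IsAlgClosed K] [CharZero K] {σ : Type*} (a b c e : MvPolynomial σ K)
    (ha : a.IsHomogeneous 1) (hb : b.IsHomogeneous 1) (hc : c.IsHomogeneous 1)
    (he : e.IsHomogeneous 1) : rankLE 4 (a * b + c * e) := by
  obtain ⟨i, hi⟩ := IsAlgClosed.exists_pow_nat_eq (-1 : K) (n := 2) (by norm_num)
  have hi' : (C i : MvPolynomial σ K) ^ 2 = -1 := by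
    rw [← C_pow, hi]; simp
  have h2 : (C (2⁻¹ : K) : MvPolynomial σ K) * 2 = 1 := by
    rw [show (2 : MvPolynomial σ K) = C 2 from (map_ofNat C 2).symm, ← C_mul]
    simp
  refine ⟨![C 2⁻¹ * (a + b), C 2⁻¹ * (C i * (a - b)), C 2⁻¹ * (c + e), C 2⁻¹ * (C i * (c - e))],
    ?_, ?_⟩
  · intro j
    fin_cases j
    · exact (ha.add hb).C_mul _
    · exact ((ha.sub hb).C_mul _).C_mul _
    · exact (hc.add he).C_mul _
    · exact ((hc.sub he).C_mul _).C_mul _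
  · simp [Fin.sum_univ_four]
    generalize (C (2⁻¹ : K) : MvPolynomial σ K) = u at *
    generalize (C i : MvPolynomial σ K) = v at *
    linear_combination (-(u*2+1)*(a*b+c*e)) * h2 - u^2*((a-b)^2+(c-e)^2)*hi'

/-- The linear form attached to an element of the span of `p`. -/
lemma exists_Z {d : ℕ} (p : Fin d → Polynomial K) (hp : LinearIndependent K p) :
    ∃ Z : Polynomial K →ₗ[K] MvPolynomial (Fin d) K,
      (∀ w, (Z w).IsHomogeneous 1) ∧
      (∀ w ∈ Submodule.span K (Set.range p), aeval p (Z w) = w) ∧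
      (∀ l : MvPolynomial (Fin d) K, l.IsHomogeneous 1 →
        ∃ w ∈ Submodule.span K (Set.range p), Z w = l) ∧
      (∀ i, Z (p i) = X i) := by
  obtain ⟨L, hL⟩ := LinearMap.exists_leftInverse_of_injective (Fintype.linearCombination K p)
    (LinearMap.ker_eq_bot.2 hp.fintypeLinearCombination_injective)
  have hLp : ∀ i, L (p i) = Pi.single i 1 := by
    intro i
    have := LinearMap.congr_fun hL (Pi.single i 1)
    simpa [Fintype.linearCombination_apply_single] using this
  have hi : ∀ i, (Fintype.linearCombination K (fun i => (X i : MvPolynomial (Fin d) K)) ∘ₗ L) (p i)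
      = X i := by
    intro i
    simp [hLp, Fintype.linearCombination_apply_single]
  refine ⟨Fintype.linearCombination K (fun i => (X i : MvPolynomial (Fin d) K)) ∘ₗ L, ?_, ?_, ?_, hi⟩
  · intro w
    simp only [LinearMap.comp_apply, Fintype.linearCombination_apply]
    refine IsHomogeneous.sum _ _ _ fun i _ => ?_
    rw [smul_eq_C_mul]
    exact isHomogeneous_C_mul_X _ _
  · intro w hw
    induction hw using Submodule.span_induction with
    | mem x hx =>
      obtain ⟨i, rfl⟩ := hx
      rw [hi]; simp
    | zero => simp
    | add x y _ _ hx hy => rw [map_add, map_add, hx, hy]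
    | smul a x _ hx => rw [map_smul, map_smul, hx]
  · intro l hl
    have : l ∈ homogeneousSubmodule (Fin d) K 1 := hl
    rw [homogeneousSubmodule_one_eq_span_X] at this
    induction this using Submodule.span_induction with
    | mem x hx =>
      obtain ⟨i, rfl⟩ := hx
      exact ⟨p i, Submodule.subset_span ⟨i, rfl⟩, hi i⟩
    | zero => exact ⟨0, zero_mem _, map_zero _⟩
    | add x y hx' hy' hx hy =>
      rw [← homogeneousSubmodule_one_eq_span_X] at hx' hy'
      obtain ⟨w, hw, rfl⟩ := hx hx'
      obtain ⟨v, hv, rfl⟩ := hy hy'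
      exact ⟨w + v, add_mem hw hv, map_add _ _ _⟩
    | smul a x hx' hx =>
      rw [← homogeneousSubmodule_one_eq_span_X] at hx'
      obtain ⟨w, hw, rfl⟩ := hx hx'
      exact ⟨a • w, Submodule.smul_mem _ _ hw, map_smul _ _ _⟩

lemma isotropic_three [CharZero K] (b c : Fin 3 → K) (hbb : ∑ i, b i ^ 2 = 0) (hbc : ∑ i, b i * c i = 0)
    (hcc : ∑ i, c i ^ 2 = 0) : c = 0 ∨ ∃ r : K, b = r • c := by
  have key : ∀ b0 b1 b2 c0 c1 c2 : K, c0 ≠ 0 → b0 ^ 2 + b1 ^ 2 + b2 ^ 2 = 0 →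
      b0 * c0 + b1 * c1 + b2 * c2 = 0 → c0 ^ 2 + c1 ^ 2 + c2 ^ 2 = 0 →
      b1 = b0 / c0 * c1 ∧ b2 = b0 / c0 * c2 := by
    intro b0 b1 b2 c0 c1 c2 h0 h1 h2 h3
    set r := b0 / c0 with hr
    have hb0 : b0 = r * c0 := by rw [hr]; field_simp
    set P := b1 - r * c1 with hP
    set Q := b2 - r * c2 with hQ
    have e1 : P ^ 2 + Q ^ 2 = 0 := by
      rw [hP, hQ]; rw [hb0] at h1 h2
      linear_combination h1 - 2 * r * h2 + r ^ 2 * h3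
    have e2 : P * c1 + Q * c2 = 0 := by
      rw [hP, hQ]; rw [hb0] at h2
      linear_combination h2 - r * h3
    have e3 : P ^ 2 * c0 ^ 2 = 0 := by
      linear_combination P^2 * h3 - (P * c1 - Q * c2) * e2 - c2^2 * e1
    have hP0 : P = 0 := by
      rcases mul_eq_zero.1 e3 with h | h
      · exact pow_eq_zero_iff (two_ne_zero) |>.1 h
      · exact absurd (pow_eq_zero_iff (two_ne_zero) |>.1 h) h0
    have hQ0 : Q = 0 := by
      rw [hP0] at e1
      have : Q ^ 2 = 0 := by linear_combination e1
      exact pow_eq_zero_iff (two_ne_zero) |>.1 this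
    exact ⟨sub_eq_zero.1 hP0, sub_eq_zero.1 hQ0⟩
  rw [Fin.sum_univ_three] at hbb hbc hcc
  by_cases h0 : c 0 = 0
  · by_cases h1 : c 1 = 0
    · left
      have h2 : c 2 = 0 := by simpa [h0, h1] using hcc
      ext i; fin_cases i <;> simp [h0, h1, h2]
    · right
      obtain ⟨k1, k2⟩ := key (b 1) (b 0) (b 2) (c 1) (c 0) (c 2) h1 (by linear_combination hbb)
        (by linear_combination hbc) (by linear_combination hcc)
      refine ⟨b 1 / c 1, ?_⟩
      ext i; fin_cases i
      · simpa using k1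
      · simp [h1]
      · simpa using k2
  · right
    obtain ⟨k1, k2⟩ := key (b 0) (b 1) (b 2) (c 0) (c 1) (c 2) h0 (by linear_combination hbb)
        (by linear_combination hbc) (by linear_combination hcc)
    refine ⟨b 0 / c 0, ?_⟩
    ext i; fin_cases i
    · simp [h0]
    · simpa using k1
    · simpa using k2


lemma natDegree_le_ind {N : ℕ} {motive : (f : Polynomial K) → f.natDegree ≤ N → Prop}
    (zero : motive 0 (by simp))
    (C_mul_pow : ∀ (k : ℕ) (r : K) (_ : r ≠ 0) (hk : k ≤ N), motive (Polynomial.C r * Polynomial.X ^ k)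
      ((Polynomial.natDegree_C_mul_X_pow_le r k).trans hk))
    (add : ∀ (u v : Polynomial K) (hu : u.natDegree ≤ N) (hv : v.natDegree ≤ N),
      motive u hu → motive v hv → motive (u + v) (Polynomial.natDegree_add_le_of_degree_le hu hv))
    (f : Polynomial K) (hf : f.natDegree ≤ N) : motive f hf := by
  have := Polynomial.induction_with_natDegree_le (fun f => ∀ hf : f.natDegree ≤ N, motive f hf) N
    (fun _ => zero) (fun k r hr hk _ => C_mul_pow k r hr hk)
    (fun u v huv hv h1 h2 _ => add u v (huv.le.trans hv) hv (h1 _) (h2 _)) f hf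
  exact this hf

lemma nilp_sq {T : Type*} [CommRing T] [Algebra K T] (e δ : T) (hee : e * e = 0) (hδδ : δ * δ = 0)
    (a b : K) : (a • e + b • δ) ^ 2 = (2 * (a * b)) • (e * δ) := by
  simp only [Algebra.smul_def, map_mul, map_ofNat]
  linear_combination (algebraMap K T a)^2 * hee + (algebraMap K T b)^2 * hδδ

lemma exists_nilp.{u} (K : Type u) [Field K] : ∃ (T : Type u) (_ : CommRing T) (_ : Algebra K T) (e δ : T),
    e * e = 0 ∧ δ * δ = 0 ∧ e * δ ≠ 0 := by
  refine ⟨DualNumber (DualNumber K), inferInstance, inferInstance,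
    TrivSqZeroExt.inl DualNumber.eps, DualNumber.eps, ?_, DualNumber.eps_mul_eps, ?_⟩
  · simp only [← TrivSqZeroExt.inl_mul, DualNumber.eps_mul_eps, TrivSqZeroExt.inl_zero]
  · intro h
    have := congrArg (fun z => TrivSqZeroExt.snd (TrivSqZeroExt.snd z)) h
    simp at this


lemma core_not_three [CharZero K] {d n : ℕ} (hn : 1 ≤ n)
    (p : Fin d → Polynomial K) (hp : LinearIndependent K p)
    (G g : Polynomial K) (hGd : G.natDegree = 3) (hX : Polynomial.X ^ 2 ∣ G)
    (hcop : IsCoprime G g)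
    (hW : ∀ w, w ∈ Submodule.span K (Set.range p) ↔ ∃ α β γ, α.natDegree ≤ n ∧
      w = G * α + (Polynomial.C β + Polynomial.C γ * Polynomial.X) * g)
    (S : Set (MvPolynomial (Fin d) K))
    (hS : ∀ q ∈ S, rankLE 3 q ∧ aeval p q = 0)
    (hJ : ∀ q : MvPolynomial (Fin d) K, q.IsHomogeneous 2 → aeval p q = 0 → q ∈ Ideal.span S) :
    False := by
  have hG0 : G ≠ 0 := by rintro rfl; simp at hGd
  obtain ⟨Z, hZ1, hZ2, hZ3, hZ4⟩ := exists_Z p hp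
  have hsmall : ∀ c0 c1 c2 : K, G ∣ Polynomial.C c0 + Polynomial.C c1 * Polynomial.X
      + Polynomial.C c2 * Polynomial.X ^ 2 → c0 = 0 ∧ c1 = 0 ∧ c2 = 0 := by
    intro c0 c1 c2 h
    have h0 := Polynomial.eq_zero_of_dvd_of_natDegree_lt h (by
      rw [hGd]; refine lt_of_le_of_lt (b := 2) ?_ (by norm_num); compute_degree)
    refine ⟨?_, ?_, ?_⟩
    · simpa [Polynomial.coeff_X, Polynomial.coeff_C] using congrArg (fun r => Polynomial.coeff r 0) h0
    · simpa [Polynomial.coeff_X, Polynomial.coeff_C, Polynomial.coeff_X_pow] using congrArg (fun r => Polynomial.coeff r 1) h0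
    · simpa [Polynomial.coeff_X, Polynomial.coeff_C] using congrArg (fun r => Polynomial.coeff r 2) h0
  -- the parametrisation
  let T : (Polynomial K × K × K) →ₗ[K] Polynomial K :=
    { toFun := fun v => G * v.1 + (Polynomial.C v.2.1 + Polynomial.C v.2.2 * Polynomial.X) * g
      map_add' := by intro u v; simp; ring
      map_smul' := by intro r v; simp [Polynomial.smul_eq_C_mul]; ring }
  have hT : ∀ α β γ, T (α, β, γ) = G * α + (Polynomial.C β + Polynomial.C γ * Polynomial.X) * g :=
    fun _ _ _ => rfl
  have hTker : LinearMap.ker T = ⊥ := by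
    rw [LinearMap.ker_eq_bot']
    rintro ⟨α, β, γ⟩ h
    rw [hT] at h
    have hd : G ∣ (Polynomial.C β + Polynomial.C γ * Polynomial.X) * g :=
      ⟨-α, by linear_combination h⟩
    have hd2 := hcop.dvd_of_dvd_mul_right hd
    obtain ⟨h0, h1, -⟩ := hsmall β γ 0 (by simpa using hd2)
    subst h0 h1
    have : α = 0 := by simpa [hG0] using h
    simp [this]
  obtain ⟨L, hL⟩ := LinearMap.exists_leftInverse_of_injective T hTker
  have hLT : ∀ α β γ, L (G * α + (Polynomial.C β + Polynomial.C γ * Polynomial.X) * g) = (α, β, γ) := by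
    intro α β γ
    rw [← hT]; exact LinearMap.congr_fun hL _
  -- nilpotent test algebra
  obtain ⟨T', _, _, e, δ, hee, hδδ, heδ⟩ := exists_nilp K
  let ψ : MvPolynomial (Fin d) K →ₐ[K] T' :=
    aeval (fun i => (L (p i)).1.coeff 0 • e + (L (p i)).2.2 • δ)
  have hψ : ∀ w ∈ Submodule.span K (Set.range p),
      ψ (Z w) = (L w).1.coeff 0 • e + (L w).2.2 • δ := by
    intro w hw
    induction hw using Submodule.span_induction with
    | mem x hx =>
      obtain ⟨i, rfl⟩ := hx
      rw [hZ4]; simp [ψ]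
    | zero => simp
    | add x y _ _ hx hy =>
      rw [map_add, map_add, hx, hy, map_add]
      simp [add_smul]; abel
    | smul a x _ hx => rw [map_smul, map_smul, hx, map_smul]; simp [smul_smul]
  have hSψ : Ideal.span S ≤ RingHom.ker ψ := by
    rw [Ideal.span_le]
    intro q hq
    obtain ⟨⟨l, hl, rfl⟩, hq0⟩ := hS q hq
    choose w hw hwl using fun i => hZ3 (l i) (hl i)
    choose α β γ hα hwe using fun i => (hW (w i)).1 (hw i)
    obtain rfl : (fun i => Z (w i)) = l := funext hwl
    have hsum : ∑ i, w i ^ 2 = 0 := by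
      rw [← hq0, map_sum]
      exact Finset.sum_congr rfl fun i _ => by rw [map_pow, hZ2 _ (hw i)]
    have hsum2 : G * (G * ∑ i, α i ^ 2 + 2 * g * (∑ i, α i * (Polynomial.C (β i) + Polynomial.C (γ i) * Polynomial.X)))
        + (Polynomial.C (∑ i, β i ^ 2) + Polynomial.C (2 * ∑ i, β i * γ i) * Polynomial.X
          + Polynomial.C (∑ i, γ i ^ 2) * Polynomial.X ^ 2) * g ^ 2 = 0 := by
      rw [← hsum]
      simp only [Fin.sum_univ_three, hwe]
      simp only [map_add, map_mul, map_pow, map_ofNat]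
      ring
    obtain ⟨h0, h1, h2⟩ := hsmall (∑ i, β i ^ 2) (2 * ∑ i, β i * γ i) (∑ i, γ i ^ 2) ((hcop.pow_right (n := 2)).dvd_of_dvd_mul_right
      ⟨-(G * ∑ i, α i ^ 2 + 2 * g * (∑ i, α i * (Polynomial.C (β i) + Polynomial.C (γ i) * Polynomial.X))),
        by linear_combination hsum2⟩)
    rw [h0, h1, h2] at hsum2
    have h1' : ∑ i, β i * γ i = 0 := by simpa using h1
    have hB : G ∣ ∑ i, α i * (Polynomial.C (β i) + Polynomial.C (γ i) * Polynomial.X) := by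
      have h3 : G * ∑ i, α i ^ 2 + 2 * g * (∑ i, α i * (Polynomial.C (β i) + Polynomial.C (γ i) * Polynomial.X)) = 0 := by
        simpa [hG0] using hsum2
      refine hcop.dvd_of_dvd_mul_left ⟨Polynomial.C (2⁻¹ : K) * -∑ i, α i ^ 2, ?_⟩
      have h2 : (Polynomial.C (2⁻¹ : K)) * 2 = 1 := by
        rw [show (2 : Polynomial K) = Polynomial.C 2 from (map_ofNat Polynomial.C 2).symm,
          ← Polynomial.C_mul]
        simp
      linear_combination (Polynomial.C (2⁻¹ : K)) * h3 - g * (∑ i, α i * (Polynomial.C (β i) + Polynomial.C (γ i) * Polynomial.X)) * h2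
    have hB2 := Polynomial.X_pow_dvd_iff.1 (hX.trans hB)
    have c0 := hB2 0 (by norm_num)
    have c1 := hB2 1 (by norm_num)
    have c0' : ∑ i, (α i).coeff 0 * β i = 0 := by
      simpa [Fin.sum_univ_three, mul_add, ← mul_assoc] using c0
    have c1' : ∑ i, ((α i).coeff 1 * β i + (α i).coeff 0 * γ i) = 0 := by
      rw [← c1, Polynomial.finsetSum_coeff]
      refine Finset.sum_congr rfl fun i _ => ?_
      rw [mul_add, ← mul_assoc, Polynomial.coeff_add, Polynomial.coeff_mul_C, Polynomial.coeff_mul_X,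
        Polynomial.coeff_mul_C]
    have hfin : ∑ i, (α i).coeff 0 * γ i = 0 := by
      rcases isotropic_three β γ h0 h1' h2 with h | ⟨r, hr⟩
      · simp [h]
      · by_cases hr0 : r = 0
        · have : β = 0 := by rw [hr, hr0, zero_smul]
          simpa [this] using c1'
        · have : r * ∑ i, (α i).coeff 0 * γ i = 0 := by
            rw [← c0', hr, Finset.mul_sum]
            exact Finset.sum_congr rfl fun i _ => by simp; ring
          exact (mul_eq_zero.1 this).resolve_left hr0
    change ψ _ = 0
    rw [map_sum]
    have : ∀ i, ψ ((fun i => Z (w i)) i ^ 2) = (2 * ((α i).coeff 0 * γ i)) • (e * δ) := by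
      intro i
      simp only [map_pow]
      rw [hψ _ (hw i)]
      rw [hwe, hLT]
      exact nilp_sq e δ hee hδδ _ _
    rw [Finset.sum_congr rfl fun i _ => this i, ← Finset.sum_smul, ← Finset.mul_sum, hfin]
    simp
  have m1 : G ∈ Submodule.span K (Set.range p) := (hW _).2 ⟨1, 0, 0, by simp, by simp⟩
  have m2 : G * Polynomial.X ∈ Submodule.span K (Set.range p) :=
    (hW _).2 ⟨Polynomial.X, 0, 0, by simpa using hn, by simp⟩
  have m3 : g ∈ Submodule.span K (Set.range p) := (hW _).2 ⟨0, 1, 0, by simp, by simp⟩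
  have m4 : Polynomial.X * g ∈ Submodule.span K (Set.range p) := (hW _).2 ⟨0, 0, 1, by simp, by simp⟩
  have hq := hSψ (hJ (Z G * Z (Polynomial.X * g) - Z (G * Polynomial.X) * Z g)
    (((hZ1 _).mul (hZ1 _)).sub ((hZ1 _).mul (hZ1 _))) (by
      simp only [map_sub, map_mul]
      rw [hZ2 _ m1, hZ2 _ m2, hZ2 _ m3, hZ2 _ m4]; ring))
  change ψ _ = 0 at hq
  have L1 : L G = (1, 0, 0) := by simpa using hLT 1 0 0
  have L2 : L (G * Polynomial.X) = (Polynomial.X, 0, 0) := by simpa using hLT Polynomial.X 0 0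
  have L3 : L g = (0, 1, 0) := by simpa using hLT 0 1 0
  have L4 : L (Polynomial.X * g) = (0, 0, 1) := by simpa using hLT 0 0 1
  simp only [map_sub, map_mul] at hq
  rw [hψ _ m1, hψ _ m2, hψ _ m3, hψ _ m4, L1, L2, L3, L4] at hq
  simp at hq
  exact heδ hq


lemma core_four [IsAlgClosed K] [CharZero K] {d n : ℕ} (hn : 2 ≤ n)
    (p : Fin d → Polynomial K) (hp : LinearIndependent K p)
    (G g : Polynomial K) (a : K)
    (hG : G = Polynomial.X ^ 2 * (Polynomial.X - Polynomial.C a))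
    (hcop : IsCoprime G g) (hg : g.natDegree ≤ 2)
    (hW : ∀ w, w ∈ Submodule.span K (Set.range p) ↔ ∃ α β γ, α.natDegree ≤ n ∧
      w = G * α + (Polynomial.C β + Polynomial.C γ * Polynomial.X) * g)
    (q : MvPolynomial (Fin d) K) (hq : q.IsHomogeneous 2) (hq0 : aeval p q = 0) :
    q ∈ Ideal.span {q : MvPolynomial (Fin d) K | q.IsHomogeneous 2 ∧ aeval p q = 0 ∧ rankLE 4 q} := by
  have hGd : G.natDegree = 3 := by rw [hG]; compute_degree!
  have hG0 : G ≠ 0 := by rintro rfl; simp at hGd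
  obtain ⟨Z, hZ1, hZ2, hZ3, -⟩ := exists_Z p hp
  have hsmall : ∀ c0 c1 c2 : K, G ∣ Polynomial.C c0 + Polynomial.C c1 * Polynomial.X
      + Polynomial.C c2 * Polynomial.X ^ 2 → c0 = 0 ∧ c1 = 0 ∧ c2 = 0 := by
    intro c0 c1 c2 h
    have h0 := Polynomial.eq_zero_of_dvd_of_natDegree_lt h (by
      rw [hGd]; refine lt_of_le_of_lt (b := 2) ?_ (by norm_num); compute_degree)
    refine ⟨?_, ?_, ?_⟩
    · simpa [Polynomial.coeff_X, Polynomial.coeff_C] using congrArg (fun r => Polynomial.coeff r 0) h0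
    · simpa [Polynomial.coeff_X, Polynomial.coeff_C, Polynomial.coeff_X_pow] using congrArg (fun r => Polynomial.coeff r 1) h0
    · simpa [Polynomial.coeff_X, Polynomial.coeff_C] using congrArg (fun r => Polynomial.coeff r 2) h0
  set I := Ideal.span {q : MvPolynomial (Fin d) K | q.IsHomogeneous 2 ∧ aeval p q = 0 ∧ rankLE 4 q} with hI
  have hIker : ∀ r ∈ I, aeval p r = 0 := by
    have : I ≤ RingHom.ker (aeval p : MvPolynomial (Fin d) K →ₐ[K] Polynomial K) := by
      rw [hI, Ideal.span_le]
      exact fun r hr => hr.2.1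
    exact fun r hr => this hr
  have R4 : ∀ w1 w2 w3 w4, w1 ∈ Submodule.span K (Set.range p) → w2 ∈ Submodule.span K (Set.range p) →
      w3 ∈ Submodule.span K (Set.range p) → w4 ∈ Submodule.span K (Set.range p) →
      w1 * w2 + w3 * w4 = 0 → Z w1 * Z w2 + Z w3 * Z w4 ∈ I := by
    intro w1 w2 w3 w4 h1 h2 h3 h4 h
    refine Ideal.subset_span ⟨((hZ1 _).mul (hZ1 _)).add ((hZ1 _).mul (hZ1 _)), ?_,
      rankLE_four _ _ _ _ (hZ1 _) (hZ1 _) (hZ1 _) (hZ1 _)⟩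
    simp only [map_add, map_mul]
    rw [hZ2 _ h1, hZ2 _ h2, hZ2 _ h3, hZ2 _ h4, h]
  have R4' : ∀ w1 w2 w3 w4, w1 ∈ Submodule.span K (Set.range p) → w2 ∈ Submodule.span K (Set.range p) →
      w3 ∈ Submodule.span K (Set.range p) → w4 ∈ Submodule.span K (Set.range p) →
      w1 * w2 = w3 * w4 → Z w1 * Z w2 - Z w3 * Z w4 ∈ I := by
    intro w1 w2 w3 w4 h1 h2 h3 h4 h
    have := R4 w1 w2 (-w3) w4 h1 h2 (neg_mem h3) h4 (by rw [h]; ring)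
    rw [map_neg] at this
    convert this using 1; ring
  have mG : ∀ α : Polynomial K, α.natDegree ≤ n → G * α ∈ Submodule.span K (Set.range p) :=
    fun α h => (hW _).2 ⟨α, 0, 0, h, by simp⟩
  have mg : g ∈ Submodule.span K (Set.range p) := (hW _).2 ⟨0, 1, 0, by simp, by simp⟩
  have mXg : Polynomial.X * g ∈ Submodule.span K (Set.range p) :=
    (hW _).2 ⟨0, 0, 1, by simp, by simp⟩
  have mGX : ∀ k ≤ n, G * Polynomial.X ^ k ∈ Submodule.span K (Set.range p) :=
    fun k hk => mG _ (by simpa using hk)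
  -- representatives
  let rA : Polynomial K →ₗ[K] MvPolynomial (Fin d) K := (Polynomial.basisMonomials K).constr K
    (fun k => Z (G * Polynomial.X ^ (min k n)) * Z (G * Polynomial.X ^ (k - min k n)))
  let rB : Polynomial K →ₗ[K] MvPolynomial (Fin d) K := (Polynomial.basisMonomials K).constr K
    (fun k => if k ≤ n then Z (G * Polynomial.X ^ k) * Z g
      else Z (G * Polynomial.X ^ (k - 1)) * Z (Polynomial.X * g))
  have rA_X : ∀ k, rA (Polynomial.X ^ k) =
      Z (G * Polynomial.X ^ (min k n)) * Z (G * Polynomial.X ^ (k - min k n)) := by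
    intro k
    have := (Polynomial.basisMonomials K).constr_basis K (fun k => Z (G * Polynomial.X ^ (min k n)) * Z (G * Polynomial.X ^ (k - min k n))) k
    simpa [Polynomial.coe_basisMonomials, Polynomial.monomial_one_right_eq_X_pow] using this
  have rB_X : ∀ k, rB (Polynomial.X ^ k) = if k ≤ n then Z (G * Polynomial.X ^ k) * Z g
      else Z (G * Polynomial.X ^ (k - 1)) * Z (Polynomial.X * g) := by
    intro k
    have := (Polynomial.basisMonomials K).constr_basis K (fun k => if k ≤ n then Z (G * Polynomial.X ^ k) * Z g
      else Z (G * Polynomial.X ^ (k - 1)) * Z (Polynomial.X * g)) k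
    simpa only [Polynomial.coe_basisMonomials, Polynomial.monomial_one_right_eq_X_pow] using this
  clear_value rA rB
  have hCmul : ∀ (r : K) (x : MvPolynomial (Fin d) K), x ∈ I → C r * x ∈ I :=
    fun r x hx => I.mul_mem_left _ hx
  have LA0 : ∀ i ≤ n, ∀ j ≤ n, Z (G * Polynomial.X ^ i) * Z (G * Polynomial.X ^ j)
      - rA (Polynomial.X ^ (i + j)) ∈ I := by
    intro i hi j hj
    rw [rA_X]
    refine R4' _ _ _ _ (mGX _ hi) (mGX _ hj) (mGX _ (by omega)) (mGX _ (by omega)) ?_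
    have : i + j = min (i + j) n + (i + j - min (i + j) n) := by omega
    have e : (Polynomial.X : Polynomial K) ^ i * Polynomial.X ^ j
        = Polynomial.X ^ (min (i + j) n) * Polynomial.X ^ (i + j - min (i + j) n) := by
      rw [← pow_add, ← pow_add, ← this]
    linear_combination G ^ 2 * e
  have LA1 : ∀ i ≤ n, ∀ b : Polynomial K, b.natDegree ≤ n → Z (G * Polynomial.X ^ i) * Z (G * b)
      - rA (Polynomial.X ^ i * b) ∈ I := by
    intro i hi b hb
    induction b, hb using natDegree_le_ind with
    | zero => simp
    | C_mul_pow k r _ hk =>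
      have := hCmul r _ (LA0 i hi k hk)
      rw [show G * (Polynomial.C r * Polynomial.X ^ k) = r • (G * Polynomial.X ^ k) by
        rw [Polynomial.smul_eq_C_mul]; ring,
        show Polynomial.X ^ i * (Polynomial.C r * Polynomial.X ^ k) = r • (Polynomial.X ^ (i + k)) by
        rw [Polynomial.smul_eq_C_mul]; ring, map_smul, map_smul, smul_eq_C_mul, smul_eq_C_mul]
      convert this using 1; ring
    | add u v _ _ hu hv =>
      rw [mul_add, mul_add, map_add, map_add]
      convert I.add_mem hu hv using 1; ring
  have LA : ∀ a : Polynomial K, a.natDegree ≤ n → ∀ b : Polynomial K, b.natDegree ≤ n →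
      Z (G * a) * Z (G * b) - rA (a * b) ∈ I := by
    intro a ha b hb
    induction a, ha using natDegree_le_ind with
    | zero => simp
    | C_mul_pow k r _ hk =>
      have := hCmul r _ (LA1 k hk b hb)
      rw [show G * (Polynomial.C r * Polynomial.X ^ k) = r • (G * Polynomial.X ^ k) by
        rw [Polynomial.smul_eq_C_mul]; ring,
        show (Polynomial.C r * Polynomial.X ^ k) * b = r • (Polynomial.X ^ k * b) by
        rw [Polynomial.smul_eq_C_mul]; ring, map_smul, map_smul, smul_eq_C_mul, smul_eq_C_mul]
      convert this using 1; ring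
    | add u v _ _ hu hv =>
      rw [mul_add, add_mul, map_add, map_add]
      convert I.add_mem hu hv using 1; ring
  have LB0 : ∀ a : Polynomial K, a.natDegree ≤ n → Z (G * a) * Z g - rB a ∈ I := by
    intro a ha
    induction a, ha using natDegree_le_ind with
    | zero => simp
    | C_mul_pow k r _ hk =>
      rw [show G * (Polynomial.C r * Polynomial.X ^ k) = r • (G * Polynomial.X ^ k) by
        rw [Polynomial.smul_eq_C_mul]; ring, ← Polynomial.smul_eq_C_mul, map_smul, map_smul, rB_X, if_pos hk]
      simp
    | add u v _ _ hu hv =>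
      rw [mul_add, map_add, map_add]
      convert I.add_mem hu hv using 1; ring
  have LB1 : ∀ a : Polynomial K, a.natDegree ≤ n → Z (G * a) * Z (Polynomial.X * g) - rB (Polynomial.X * a) ∈ I := by
    intro a ha
    induction a, ha using natDegree_le_ind with
    | zero => simp
    | C_mul_pow k r _ hk =>
      rw [show G * (Polynomial.C r * Polynomial.X ^ k) = r • (G * Polynomial.X ^ k) by
        rw [Polynomial.smul_eq_C_mul]; ring,
        show Polynomial.X * (Polynomial.C r * Polynomial.X ^ k) = r • (Polynomial.X ^ (k + 1)) by
        rw [Polynomial.smul_eq_C_mul]; ring, map_smul, map_smul, rB_X]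
      have : Z (G * Polynomial.X ^ k) * Z (Polynomial.X * g) -
        (if k + 1 ≤ n then Z (G * Polynomial.X ^ (k + 1)) * Z g
          else Z (G * Polynomial.X ^ (k + 1 - 1)) * Z (Polynomial.X * g)) ∈ I := by
        split_ifs with h
        · exact R4' _ _ _ _ (mGX _ hk) mXg (mGX _ h) mg (by ring)
        · simp
      have := hCmul r _ this
      rw [smul_eq_C_mul, smul_eq_C_mul]
      convert this using 1; ring
    | add u v _ _ hu hv =>
      rw [mul_add, mul_add, map_add, map_add]
      convert I.add_mem hu hv using 1; ring
  -- images of the representatives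
  have iA : ∀ A : Polynomial K, A.natDegree ≤ 2 * n → aeval p (rA A) = G ^ 2 * A := by
    intro A hA
    induction A, hA using natDegree_le_ind with
    | zero => simp
    | C_mul_pow k r _ hk =>
      rw [← Polynomial.smul_eq_C_mul, map_smul, map_smul, rA_X, map_mul, hZ2 _ (mGX _ (by omega)),
        hZ2 _ (mGX _ (by omega)), Polynomial.smul_eq_C_mul, Polynomial.smul_eq_C_mul]
      have : k = min k n + (k - min k n) := by omega
      have e : (Polynomial.X : Polynomial K) ^ k
        = Polynomial.X ^ (min k n) * Polynomial.X ^ (k - min k n) := by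
        rw [← pow_add, ← this]
      linear_combination -Polynomial.C r * G ^ 2 * e
    | add u v _ _ hu hv => rw [map_add, map_add, hu, hv]; ring
  have iB : ∀ B : Polynomial K, B.natDegree ≤ n + 1 → aeval p (rB B) = G * g * B := by
    intro A hA
    induction A, hA using natDegree_le_ind with
    | zero => simp
    | C_mul_pow k r _ hk =>
      rw [← Polynomial.smul_eq_C_mul, map_smul, map_smul, rB_X, Polynomial.smul_eq_C_mul,
        Polynomial.smul_eq_C_mul]
      split_ifs with h
      · rw [map_mul, hZ2 _ (mGX _ h), hZ2 _ mg]; ring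
      · rw [map_mul, hZ2 _ (mGX _ (by omega)), hZ2 _ mXg]
        obtain ⟨m, rfl⟩ : ∃ m, k = m + 1 := ⟨k - 1, by omega⟩
        rw [Nat.add_sub_cancel]; ring
    | add u v _ _ hu hv => rw [map_add, map_add, hu, hv]; ring
  -- decomposition of a quadric
  have hdec : ∃ A B : Polynomial K, ∃ c0 c1 c2 : K, A.natDegree ≤ 2 * n ∧ B.natDegree ≤ n + 1 ∧
      q - (rA A + rB B + (C c0 * Z g ^ 2 + C c1 * (Z g * Z (Polynomial.X * g))
        + C c2 * Z (Polynomial.X * g) ^ 2)) ∈ I := by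
    have hq' : q ∈ homogeneousSubmodule (Fin d) K 2 := hq
    rw [← homogeneousSubmodule_one_pow, pow_two] at hq'
    clear hq hq0
    induction hq' using Submodule.mul_induction_on' with
    | mem_mul_mem l hl m hm =>
      obtain ⟨w, hw, rfl⟩ := hZ3 l hl
      obtain ⟨v, hv, rfl⟩ := hZ3 m hm
      obtain ⟨α, β, γ, hα, rfl⟩ := (hW w).1 hw
      obtain ⟨α', β', γ', hα', rfl⟩ := (hW v).1 hv
      have hZe : ∀ α β γ, Z (G * α + (Polynomial.C β + Polynomial.C γ * Polynomial.X) * g)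
          = Z (G * α) + C β * Z g + C γ * Z (Polynomial.X * g) := by
        intro α β γ
        rw [show G * α + (Polynomial.C β + Polynomial.C γ * Polynomial.X) * g
          = G * α + β • g + γ • (Polynomial.X * g) by
            rw [Polynomial.smul_eq_C_mul, Polynomial.smul_eq_C_mul]; ring]
        rw [map_add, map_add, map_smul, map_smul, smul_eq_C_mul, smul_eq_C_mul]
      refine ⟨α * α', β' • α + γ' • (Polynomial.X * α) + β • α' + γ • (Polynomial.X * α'), β * β', β * γ' + β' * γ, γ * γ', ?_, ?_, ?_⟩
      · exact Polynomial.natDegree_mul_le.trans (by omega)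
      · have hXd : ∀ u : Polynomial K, u.natDegree ≤ n → (Polynomial.X * u).natDegree ≤ n + 1 := by
          intro u hu
          refine Polynomial.natDegree_mul_le.trans ?_
          rw [Polynomial.natDegree_X]; omega
        refine Polynomial.natDegree_add_le_of_degree_le (Polynomial.natDegree_add_le_of_degree_le
          (Polynomial.natDegree_add_le_of_degree_le ?_ ?_) ?_) ?_
        · exact (Polynomial.natDegree_smul_le _ _).trans (by omega)
        · exact (Polynomial.natDegree_smul_le _ _).trans (hXd _ hα)
        · exact (Polynomial.natDegree_smul_le _ _).trans (by omega)
        · exact (Polynomial.natDegree_smul_le _ _).trans (hXd _ hα')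
      · rw [hZe, hZe]
        simp only [map_add, map_smul, smul_eq_C_mul, map_mul]
        have := I.add_mem (LA α hα α' hα') (I.add_mem (I.add_mem (hCmul β' _ (LB0 α hα)) (hCmul γ' _ (LB1 α hα)))
          (I.add_mem (hCmul β _ (LB0 α' hα')) (hCmul γ _ (LB1 α' hα'))))
        convert this using 1; ring
    | add x hx y hy hx' hy' =>
      obtain ⟨A, B, c0, c1, c2, hA, hB, h⟩ := hx'
      obtain ⟨A', B', c0', c1', c2', hA', hB', h'⟩ := hy'
      refine ⟨A + A', B + B', c0 + c0', c1 + c1', c2 + c2', Polynomial.natDegree_add_le_of_degree_le hA hA',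
        Polynomial.natDegree_add_le_of_degree_le hB hB', ?_⟩
      simp only [map_add]
      convert I.add_mem h h' using 1; ring
  obtain ⟨A, B, c0, c1, c2, hA, hB, hqI⟩ := hdec
  have him := hIker _ hqI
  rw [map_sub, hq0, map_add, map_add, iA A hA, iB B hB] at him
  simp only [map_add, map_mul, map_pow] at him
  rw [hZ2 _ mg, hZ2 _ mXg, aeval_C, aeval_C, aeval_C, Polynomial.algebraMap_eq] at him
  obtain ⟨rfl, rfl, rfl⟩ := hsmall c0 c1 c2 ((hcop.pow_right (n := 2)).dvd_of_dvd_mul_right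
      ⟨-(G * A + g * B), by linear_combination -him⟩)
  simp only [map_zero, zero_mul, add_zero] at him hqI
  have him2 : G * A + g * B = 0 := by
    have : G * (G * A + g * B) = 0 := by linear_combination -him
    exact (mul_eq_zero.1 this).resolve_left hG0
  obtain ⟨E, rfl⟩ : G ∣ B := hcop.dvd_of_dvd_mul_left ⟨-A, by linear_combination him2⟩
  obtain rfl : A = -(g * E) := by
    have : G * (A + g * E) = 0 := by linear_combination him2
    have := (mul_eq_zero.1 this).resolve_left hG0
    linear_combination this
  suffices hE : rA (-(g * E)) + rB (G * E) ∈ I by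
    convert I.add_mem hqI hE using 1; ring
  by_cases hE0 : E = 0
  · simp [hE0]
  have hEd : E.natDegree + 2 ≤ n := by
    rw [Polynomial.natDegree_mul hG0 hE0, hGd] at hB; omega
  obtain ⟨v, hv⟩ : ∃ v, g = Polynomial.X * v + Polynomial.C (g.coeff 0) :=
    ⟨g.divX, (Polynomial.X_mul_divX_add g).symm⟩
  set r := g.coeff 0
  have hvd : v.natDegree ≤ 2 := by
    have : (Polynomial.X * v).natDegree ≤ 2 := by
      rw [show Polynomial.X * v = g - Polynomial.C r by rw [hv]; ring]
      exact (Polynomial.natDegree_sub_le _ _).trans (by simpa using hg)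
    by_cases h0 : v = 0
    · simp [h0]
    · rw [Polynomial.natDegree_X_mul h0] at this; omega
  have hc1d : (Polynomial.X ^ 2 - Polynomial.C a * Polynomial.X - 1 : Polynomial K).natDegree ≤ 2 := by
    compute_degree
  have d1 : (E * Polynomial.X).natDegree ≤ n :=
    Polynomial.natDegree_mul_le.trans (by rw [Polynomial.natDegree_X]; omega)
  have d2 : (E * (Polynomial.X ^ 2 - Polynomial.C a * Polynomial.X - 1)).natDegree ≤ n :=
    Polynomial.natDegree_mul_le.trans (by omega)
  have d3 : (-(Polynomial.C r * (Polynomial.X - Polynomial.C a) + v)).natDegree ≤ n := by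
    rw [Polynomial.natDegree_neg]
    refine Polynomial.natDegree_add_le_of_degree_le (le_trans (b := 1) ?_ (by omega)) (by omega)
    compute_degree
  have d4 : (Polynomial.C r : Polynomial K).natDegree ≤ n := by simp
  set c₀ : Polynomial K := Polynomial.X with hc₀
  set c₁ : Polynomial K := Polynomial.X ^ 2 - Polynomial.C a * Polynomial.X - 1 with hc₁
  set n₀ : Polynomial K := -(Polynomial.C r * (Polynomial.X - Polynomial.C a) + v) with hn₀
  have key1 : c₀ + Polynomial.X * c₁ = G := by rw [hG, hc₁]; ring
  have key2 : c₀ * n₀ + c₁ * Polynomial.C r = -g := by rw [hv, hn₀, hc₁]; ring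
  have hqE := R4 (G * (E * c₀)) (g + G * n₀) (G * (E * c₁)) (Polynomial.X * g + G * Polynomial.C r)
    (mG _ d1) (add_mem mg (mG _ d3)) (mG _ d2) (add_mem mXg (mG _ d4)) (by
      linear_combination G * E * g * key1 + G ^ 2 * E * key2)
  have hsumm := I.sub_mem hqE (I.add_mem (I.add_mem (LB0 _ d1) (LA _ d1 _ d3)) (I.add_mem (LB1 _ d2) (LA _ d2 _ d4)))
  have eA : rA (-(g * E)) = rA (E * c₀ * n₀) + rA (E * c₁ * Polynomial.C r) := by
    rw [← map_add]; congr 1; linear_combination -E * key2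
  have eB : rB (G * E) = rB (E * c₀) + rB (Polynomial.X * (E * c₁)) := by
    rw [← map_add]; congr 1; linear_combination -E * key1
  rw [eA, eB]
  simp only [map_add] at hsumm
  convert hsumm using 1; ring


lemma middle {n : ℕ} (hn : 1 ≤ n) (lam : Polynomial K →ₗ[K] K)
    (p : Fin (n + 3) → Polynomial K) (hp : LinearIndependent K p)
    (hspan : ∀ P : Polynomial K, P.natDegree ≤ n + 3 → lam P = 0 → P ∈ Submodule.span K (Set.range p))
    (G : Polynomial K) (hGd : G.natDegree = 3)
    (hG : ∀ H : Polynomial K, H.natDegree ≤ n → lam (G * H) = 0)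
    (hnd : ∀ P : Polynomial K, P.natDegree ≤ 2 →
      (∀ H : Polynomial K, H.natDegree ≤ n + 1 → lam (P * H) = 0) → P = 0) :
    ∃ g : Polynomial K, g.natDegree ≤ 2 ∧ IsCoprime G g ∧
      ∀ w, w ∈ Submodule.span K (Set.range p) ↔ ∃ α β γ, α.natDegree ≤ n ∧
      w = G * α + (Polynomial.C β + Polynomial.C γ * Polynomial.X) * g := by
  have hG0 : G ≠ 0 := by rintro rfl; simp at hGd
  have hdlt : ∀ (m : ℕ) (P : Polynomial K), P ∈ Polynomial.degreeLT K (m + 1) ↔ P.natDegree ≤ m := by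
    intro m P
    rw [Polynomial.mem_degreeLT]
    by_cases h0 : P = 0
    · simp [h0]
    · rw [← Polynomial.natDegree_lt_iff_degree_lt h0, Nat.lt_succ_iff]
  have hfr : ∀ m, Module.finrank K (Polynomial.degreeLT K m) = m := by
    intro m
    rw [Module.finrank_eq_card_basis (Polynomial.degreeLT.basis K m), Fintype.card_fin]
  let F : Polynomial.degreeLT K 3 →ₗ[K] K × K :=
    (lam.prod (lam ∘ₗ LinearMap.mulLeft K Polynomial.X)) ∘ₗ (Polynomial.degreeLT K 3).subtype
  have hF : LinearMap.ker F ≠ ⊥ := LinearMap.ker_ne_bot_of_finrank_lt (by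
    rw [hfr]; simp)
  obtain ⟨⟨g, hgm⟩, hgk, hg0⟩ := (Submodule.ne_bot_iff _).1 hF
  have hg0' : g ≠ 0 := by
    intro h; apply hg0; exact Subtype.ext h
  have hgd : g.natDegree ≤ 2 := (hdlt 2 g).1 hgm
  have hgk' : F ⟨g, hgm⟩ = 0 := hgk
  have hl1 : lam g = 0 := congrArg Prod.fst hgk'
  have hl2 : lam (Polynomial.X * g) = 0 := congrArg Prod.snd hgk'
  have hlin : ∀ β γ : K, lam ((Polynomial.C β + Polynomial.C γ * Polynomial.X) * g) = 0 := by
    intro β γ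
    rw [show (Polynomial.C β + Polynomial.C γ * Polynomial.X) * g = β • g + γ • (Polynomial.X * g) by
      rw [Polynomial.smul_eq_C_mul, Polynomial.smul_eq_C_mul]; ring, map_add, map_smul, map_smul,
      hl1, hl2]
    simp
  have hcop : IsCoprime G g := by
    classical
    rw [← EuclideanDomain.gcd_isUnit_iff]
    by_contra hu
    obtain ⟨G2, hG2⟩ := EuclideanDomain.gcd_dvd_left G g
    obtain ⟨g2, hg2⟩ := EuclideanDomain.gcd_dvd_right G g
    set D := EuclideanDomain.gcd G g
    have hD0 : D ≠ 0 := by rintro h; rw [h, zero_mul] at hG2; exact hG0 hG2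
    have hG20 : G2 ≠ 0 := by rintro h; rw [h, mul_zero] at hG2; exact hG0 hG2
    have hDd : 1 ≤ D.natDegree := by
      by_contra h
      apply hu
      rw [Polynomial.isUnit_iff_degree_eq_zero, Polynomial.degree_eq_natDegree hD0]
      norm_cast; omega
    have hG2d : G2.natDegree ≤ 2 := by
      have := hGd; rw [hG2, Polynomial.natDegree_mul hD0 hG20] at this; omega
    apply hg0'
    refine hnd g hgd fun H hH => ?_
    have hdiv := EuclideanDomain.div_add_mod H G2
    have hmod : (H % G2).natDegree ≤ 1 := by
      have := Polynomial.degree_mod_lt H hG20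
      by_cases h0 : H % G2 = 0
      · simp [h0]
      · have := Polynomial.natDegree_lt_natDegree h0 this; omega
    obtain ⟨r1, r0, hr⟩ := Polynomial.exists_eq_X_add_C_of_natDegree_le_one hmod
    have e1 : g * H = G * (g2 * (H / G2)) + (Polynomial.C r0 + Polynomial.C r1 * Polynomial.X) * g := by
      rw [hr] at hdiv
      linear_combination -g * hdiv - g2 * (H / G2) * hG2 + G2 * (H / G2) * hg2
    rw [e1, map_add, hlin, add_zero]
    apply hG
    by_cases h0 : g2 * (H / G2) = 0
    · simp [h0]
    · have : (G * (g2 * (H / G2))).natDegree ≤ n + 3 := by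
        rw [show G * (g2 * (H / G2)) = g * H - (Polynomial.C r0 + Polynomial.C r1 * Polynomial.X) * g by
          rw [e1]; ring]
        refine (Polynomial.natDegree_sub_le _ _).trans (max_le ?_ ?_)
        · exact Polynomial.natDegree_mul_le.trans (by omega)
        · refine Polynomial.natDegree_mul_le.trans ?_
          have : (Polynomial.C r0 + Polynomial.C r1 * Polynomial.X : Polynomial K).natDegree ≤ 1 := by
            compute_degree
          omega
      rw [Polynomial.natDegree_mul hG0 h0, hGd] at this; omega
  refine ⟨g, hgd, hcop, ?_⟩
  let T : (Polynomial.degreeLT K (n + 1) × K × K) →ₗ[K] Polynomial K :=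
    { toFun := fun v => G * (v.1 : Polynomial K) + (Polynomial.C v.2.1 + Polynomial.C v.2.2 * Polynomial.X) * g
      map_add' := by intro u v; simp; ring
      map_smul' := by intro r v; simp [Polynomial.smul_eq_C_mul]; ring }
  have hT : ∀ α β γ, T (α, β, γ) = G * (α : Polynomial K) + (Polynomial.C β + Polynomial.C γ * Polynomial.X) * g :=
    fun _ _ _ => rfl
  have hTker : LinearMap.ker T = ⊥ := by
    rw [LinearMap.ker_eq_bot']
    rintro ⟨α, β, γ⟩ h
    rw [hT] at h
    have hd : G ∣ (Polynomial.C β + Polynomial.C γ * Polynomial.X) * g :=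
      ⟨-α, by linear_combination h⟩
    have h0 := Polynomial.eq_zero_of_dvd_of_natDegree_lt (hcop.dvd_of_dvd_mul_right hd) (by
      rw [hGd]; refine lt_of_le_of_lt (b := 1) ?_ (by norm_num); compute_degree)
    have hβ : β = 0 := by
      simpa [Polynomial.coeff_X, Polynomial.coeff_C] using congrArg (fun r => Polynomial.coeff r 0) h0
    have hγ : γ = 0 := by
      simpa [Polynomial.coeff_X, Polynomial.coeff_C] using congrArg (fun r => Polynomial.coeff r 1) h0
    subst hβ hγ
    have : α = 0 := by simpa [hG0] using h
    simp [this]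
  have hle : LinearMap.range T ≤ Submodule.span K (Set.range p) := by
    rintro _ ⟨⟨α, β, γ⟩, rfl⟩
    have hα : (α : Polynomial K).natDegree ≤ n := (hdlt n _).1 α.2
    rw [hT]
    apply hspan
    · refine Polynomial.natDegree_add_le_of_degree_le ?_ ?_
      · exact Polynomial.natDegree_mul_le.trans (by omega)
      · refine Polynomial.natDegree_mul_le.trans ?_
        have : (Polynomial.C β + Polynomial.C γ * Polynomial.X : Polynomial K).natDegree ≤ 1 := by
          compute_degree
        omega
    · rw [map_add, hlin, hG _ hα, add_zero]
  have heq : LinearMap.range T = Submodule.span K (Set.range p) := by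
    have : FiniteDimensional K (Submodule.span K (Set.range p)) :=
      FiniteDimensional.span_of_finite K (Set.finite_range p)
    refine Submodule.eq_of_le_of_finrank_eq hle ?_
    rw [LinearMap.finrank_range_of_inj (LinearMap.ker_eq_bot.1 hTker), finrank_span_eq_card hp]
    simp [hfr]
  intro w
  rw [← heq]
  constructor
  · rintro ⟨⟨α, β, γ⟩, rfl⟩
    exact ⟨α, β, γ, (hdlt n _).1 α.2, hT _ _ _⟩
  · rintro ⟨α, β, γ, hα, rfl⟩
    exact ⟨(⟨α, (hdlt n _).2 hα⟩, β, γ), hT _ _ _⟩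


/-- The linear functional `G ↦ (G ∘ f)(0)`. -/
noncomputable def Lam (f : MvPolynomial (Fin 2) K) : MvPolynomial (Fin 2) K →ₗ[K] K :=
  (basisMonomials (Fin 2) K).constr K
    (fun a => ((a 0).factorial : K) * ((a 1).factorial : K) * coeff a f)

lemma Lam_monomial (f : MvPolynomial (Fin 2) K) (a : Fin 2 →₀ ℕ) (r : K) :
    Lam f (monomial a r) = r * (((a 0).factorial : K) * ((a 1).factorial : K) * coeff a f) := by
  have := (basisMonomials (Fin 2) K).constr_basis K
    (fun a => ((a 0).factorial : K) * ((a 1).factorial : K) * coeff a f) a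
  rw [coe_basisMonomials] at this
  rw [show (monomial a r : MvPolynomial (Fin 2) K) = r • monomial a 1 by simp [smul_monomial], map_smul]
  rw [Lam, this, smul_eq_mul]

lemma Lam_eq_zero {f : MvPolynomial (Fin 2) K} {d e : ℕ} (hf : f.IsHomogeneous d)
    {G : MvPolynomial (Fin 2) K} (hG : G.IsHomogeneous e) (hne : e ≠ d) : Lam f G = 0 := by
  rw [G.as_sum, map_sum]
  refine Finset.sum_eq_zero fun a ha => ?_
  rw [Lam_monomial, hf.coeff_eq_zero (d := a), mul_zero, mul_zero]
  have := hG.degree_eq_sum_deg_support ha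
  have h2 : a.degree = e := this.symm
  omega

lemma coeff_iter_pderiv (i : Fin 2) (k : ℕ) : ∀ (F : MvPolynomial (Fin 2) K) (m : Fin 2 →₀ ℕ),
    coeff m ((⇑(pderiv i))^[k] F) * ((m i).factorial : K)
      = ((m i + k).factorial : K) * coeff (m + Finsupp.single i k) F := by
  induction k with
  | zero => intro F m; simp [mul_comm]
  | succ k ih =>
    intro F m
    rw [Function.iterate_succ_apply, ih, coeff_pderiv]
    simp only [Finsupp.add_apply, Finsupp.single_eq_same, add_assoc, ← Finsupp.single_add]
    rw [← add_assoc (m i) k 1, Nat.factorial_succ]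
    push_cast
    ring

lemma coeff_apolar (G f : MvPolynomial (Fin 2) K) (m : Fin 2 →₀ ℕ) :
    coeff m (apolar G f) * (((m 0).factorial : K) * ((m 1).factorial : K))
      = Lam f (monomial m 1 * G) := by
  conv_rhs => rw [G.as_sum, Finset.mul_sum, map_sum]
  rw [apolar, coeff_sum, Finset.sum_mul]
  refine Finset.sum_congr rfl fun a _ => ?_
  rw [monomial_mul, one_mul, Lam_monomial, coeff_smul, smul_eq_mul]
  have h0 := coeff_iter_pderiv 0 (a 0) ((⇑(pderiv (1 : Fin 2)))^[a 1] f) m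
  have h1 := coeff_iter_pderiv 1 (a 1) f (m + Finsupp.single 0 (a 0))
  have e : m + Finsupp.single 0 (a 0) + Finsupp.single 1 (a 1) = m + a := by
    ext i; fin_cases i <;> simp
  rw [e] at h1
  simp at h1
  simp only [Finsupp.add_apply]
  linear_combination coeff a G * ((m 1).factorial : K) * h0 + coeff a G * ((m 0 + a 0).factorial : K) * h1

lemma apolar_eq_zero_iff [CharZero K] (G f : MvPolynomial (Fin 2) K) :
    apolar G f = 0 ↔ ∀ m, Lam f (monomial m 1 * G) = 0 := by
  constructor
  · intro h m
    rw [← coeff_apolar, h]; simp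
  · intro h
    ext m
    have := coeff_apolar G f m
    rw [h m] at this
    rw [coeff_zero]
    refine (mul_eq_zero.1 this).resolve_right ?_
    refine mul_ne_zero ?_ ?_ <;> exact_mod_cast Nat.factorial_ne_zero _

lemma apolar_zero_Lam [CharZero K] {G f : MvPolynomial (Fin 2) K} (h : apolar G f = 0)
    (N : MvPolynomial (Fin 2) K) : Lam f (G * N) = 0 := by
  rw [N.as_sum, Finset.mul_sum, map_sum]
  refine Finset.sum_eq_zero fun a _ => ?_
  have := (apolar_eq_zero_iff G f).1 h a
  rw [show (G * monomial a (coeff a N)) = coeff a N • (monomial a 1 * G) by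
    rw [← smul_mul_assoc, smul_monomial, mul_comm]; simp, map_smul, this, smul_zero]

lemma Lam_zero_apolar [CharZero K] {d e k : ℕ} {G f : MvPolynomial (Fin 2) K} (hf : f.IsHomogeneous d)
    (hG : G.IsHomogeneous e) (hk : e + k = d)
    (h : ∀ N : MvPolynomial (Fin 2) K, N.IsHomogeneous k → Lam f (G * N) = 0) : apolar G f = 0 := by
  rw [apolar_eq_zero_iff]
  intro m
  have hm : (monomial m (1 : K)).IsHomogeneous m.degree := isHomogeneous_monomial _ rfl
  by_cases hmk : m.degree = k
  · rw [mul_comm]; exact h _ (hmk ▸ hm)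
  · exact Lam_eq_zero hf (hm.mul hG) (by omega)

lemma eval_smul_of_hom {m : ℕ} {F : MvPolynomial (Fin 2) K} (hF : F.IsHomogeneous m) (c : K)
    (v w : Fin 2 → K) (hv : ∀ i, v i = c * w i) : eval v F = c ^ m * eval w F := by
  rw [eval_eq', eval_eq', Finset.mul_sum]
  refine Finset.sum_congr rfl fun a ha => ?_
  have := hF.degree_eq_sum_deg_support ha
  have hs : a 0 + a 1 = m := by
    have h2 : a.degree = m := this.symm
    rwa [Finsupp.degree_eq_sum, Fin.sum_univ_two] at h2
  simp only [Fin.prod_univ_two, hv, ← hs, mul_pow, pow_add]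
  ring

lemma dehom [CharZero K] (P Q : Fin 2 → K) (hΔ : P 0 * Q 1 - P 1 * Q 0 ≠ 0) :
    ∃ (D : MvPolynomial (Fin 2) K →ₐ[K] Polynomial K)
      (η : ℕ → Polynomial K →ₗ[K] MvPolynomial (Fin 2) K),
      (∀ m F, F.IsHomogeneous m → (D F).natDegree ≤ m) ∧
      (∀ m A, (η m A).IsHomogeneous m) ∧
      (∀ m A, A.natDegree ≤ m → D (η m A) = A) ∧
      (∀ m F, F.IsHomogeneous m → D F = 0 → F = 0) ∧
      (∀ m A, eval P (η m A) = A.coeff m) ∧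
      (∀ i, D (X i) = Polynomial.C (P i) * Polynomial.X + Polynomial.C (Q i)) := by
  set Δ := P 0 * Q 1 - P 1 * Q 0 with hΔdef
  let D : MvPolynomial (Fin 2) K →ₐ[K] Polynomial K :=
    aeval (fun i => Polynomial.C (P i) * Polynomial.X + Polynomial.C (Q i))
  have hD : ∀ i, D (X i) = Polynomial.C (P i) * Polynomial.X + Polynomial.C (Q i) := by
    intro i; simp [D]
  have hDC : ∀ r, D (C r) = Polynomial.C r := by intro r; simp [D]
  let σ : MvPolynomial (Fin 2) K := C Δ⁻¹ * (C (Q 1) * X 0 - C (Q 0) * X 1)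
  let τ : MvPolynomial (Fin 2) K := C Δ⁻¹ * (C (P 0) * X 1 - C (P 1) * X 0)
  have hσ1 : σ.IsHomogeneous 1 :=
    ((isHomogeneous_C_mul_X _ _).sub (isHomogeneous_C_mul_X _ _)).C_mul _
  have hτ1 : τ.IsHomogeneous 1 :=
    ((isHomogeneous_C_mul_X _ _).sub (isHomogeneous_C_mul_X _ _)).C_mul _
  have hC : (Polynomial.C Δ⁻¹ : Polynomial K) * (Polynomial.C (P 0) * Polynomial.C (Q 1)
      - Polynomial.C (P 1) * Polynomial.C (Q 0)) = 1 := by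
    rw [← Polynomial.C_mul, ← Polynomial.C_mul, ← Polynomial.C_sub, ← Polynomial.C_mul, ← hΔdef,
      inv_mul_cancel₀ hΔ, Polynomial.C_1]
  have hDσ : D σ = Polynomial.X := by
    simp only [σ, map_mul, map_sub, hDC, hD]
    linear_combination Polynomial.X * hC
  have hDτ : D τ = 1 := by
    simp only [τ, map_mul, map_sub, hDC, hD]
    linear_combination hC
  have hPσ : eval P σ = 1 := by
    simp only [σ, map_mul, map_sub, eval_C, eval_X]
    field_simp; rw [hΔdef]; ring
  have hPτ : eval P τ = 0 := by
    simp only [τ, map_mul, map_sub, eval_C, eval_X]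
    ring
  let η : ℕ → Polynomial K →ₗ[K] MvPolynomial (Fin 2) K := fun m =>
    ∑ i ∈ Finset.range (m + 1), (Polynomial.lcoeff K i).smulRight (σ ^ i * τ ^ (m - i))
  have hη : ∀ m A, η m A = ∑ i ∈ Finset.range (m + 1), C (A.coeff i) * (σ ^ i * τ ^ (m - i)) := by
    intro m A
    simp [η, smul_eq_C_mul]
  refine ⟨D, η, ?_, ?_, ?_, ?_, ?_, hD⟩
  · intro m F hF
    rw [F.as_sum, map_sum]
    refine Polynomial.natDegree_sum_le_of_forall_le _ _ fun a ha => ?_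
    have := hF.degree_eq_sum_deg_support ha
    have hs : a 0 + a 1 = m := by
      have h2 : a.degree = m := this.symm
      rwa [Finsupp.degree_eq_sum, Fin.sum_univ_two] at h2
    rw [aeval_monomial, Finsupp.prod_fintype _ _ (by simp), Fin.prod_univ_two, Polynomial.algebraMap_eq]
    have hl : ∀ i, (Polynomial.C (P i) * Polynomial.X + Polynomial.C (Q i)).natDegree ≤ 1 :=
      fun i => Polynomial.natDegree_linear_le
    refine (Polynomial.natDegree_C_mul_le _ _).trans ?_
    refine Polynomial.natDegree_mul_le.trans ?_
    have h0 := Polynomial.natDegree_pow_le_of_le (a 0) (hl 0)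
    have h1 := Polynomial.natDegree_pow_le_of_le (a 1) (hl 1)
    omega
  · intro m A
    rw [hη]
    refine IsHomogeneous.sum _ _ _ fun i hi => IsHomogeneous.C_mul ?_ _
    have := (hσ1.pow i).mul (hτ1.pow (m - i))
    have hi' := Finset.mem_range.1 hi
    rwa [show 1 * i + 1 * (m - i) = m by omega] at this
  · intro m A hA
    rw [hη, map_sum]
    conv_rhs => rw [A.as_sum_range_C_mul_X_pow' (show A.natDegree < m + 1 by omega)]
    refine Finset.sum_congr rfl fun i _ => ?_
    rw [map_mul, map_mul, map_pow, map_pow, hDσ, hDτ, hDC]; simp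
  · intro m F hF h0
    have hτne : τ ≠ 0 := by
      intro h; rw [h, map_zero] at hDτ; exact zero_ne_one hDτ
    have : F * τ = 0 := by
      refine MvPolynomial.funext fun v => ?_
      rw [map_mul, map_zero]
      by_cases hv : eval v τ = 0
      · rw [hv, mul_zero]
      · have hsc : eval v F = (eval v τ) ^ m * eval (fun i => P i * (eval v σ / eval v τ) + Q i) F := by
          refine eval_smul_of_hom hF _ _ _ fun i => ?_
          have h1 : P i * eval v σ + Q i * eval v τ = v i := by
            simp only [σ, τ, map_mul, map_sub, eval_C, eval_X]
            field_simp
            rw [hΔdef]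
            fin_cases i <;> simp <;> ring
          rw [← h1]; field_simp
        have hz : eval (fun i => P i * (eval v σ / eval v τ) + Q i) F = 0 := by
          have h2 := congrArg (Polynomial.eval (eval v σ / eval v τ)) h0
          have h3 : ∀ (z : K) (F : MvPolynomial (Fin 2) K), Polynomial.eval z (D F)
              = eval (fun i => P i * z + Q i) F := by
            intro z F
            induction F using MvPolynomial.induction_on with
            | C r => simp [hDC]
            | add p q hp hq => simp [hp, hq]
            | mul_X p i hp => rw [map_mul, Polynomial.eval_mul, hp, hD]; simp
          rw [h3] at h2
          simpa using h2
        rw [hsc, hz]; simp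
    exact (mul_eq_zero.1 this).resolve_right hτne
  · intro m A
    rw [hη, map_sum, Finset.sum_eq_single m]
    · simp [hPσ]
    · intro i hi him
      have hi' := Finset.mem_range.1 hi
      rw [map_mul, map_mul, map_pow, map_pow, hPτ, zero_pow (by omega)]; simp
    · simp


lemma lin_form {ℓ : MvPolynomial (Fin 2) K} (hℓ : ℓ.IsHomogeneous 1) :
    ∃ a : Fin 2 → K, ℓ = C (a 0) * X 0 + C (a 1) * X 1 := by
  have h1 : ℓ ∈ homogeneousSubmodule (Fin 2) K 1 := hℓ
  rw [homogeneousSubmodule_one_eq_span_X] at h1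
  obtain ⟨a, ha⟩ := (Submodule.mem_span_range_iff_exists_fun K).1 h1
  refine ⟨a, ?_⟩
  rw [← ha, Fin.sum_univ_two, smul_eq_C_mul, smul_eq_C_mul]

end core

theorem stmt13 {K : Type*} [Field K] [IsAlgClosed K] [CharZero K]
    (d : ℕ) (hd : 5 ≤ d) (f : MvPolynomial (Fin 2) K) (hf : f ≠ 0) (hfd : f.IsHomogeneous d)
    (hno2 : ∀ G : MvPolynomial (Fin 2) K, G.IsHomogeneous 2 → apolar G f = 0 → G = 0)
    (hex3 : ∃ g : MvPolynomial (Fin 2) K, g ≠ 0 ∧ g.IsHomogeneous 3 ∧ apolar g f = 0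
      ∧ ∃ ℓ : MvPolynomial (Fin 2) K, ℓ ≠ 0 ∧ ℓ.IsHomogeneous 1 ∧ ℓ ^ 2 ∣ g)
    (h : Fin d → MvPolynomial (Fin 2) K) (hind : LinearIndependent K h)
    (hspan : (Submodule.span K (Set.range h) : Set (MvPolynomial (Fin 2) K))
      = {G | G.IsHomogeneous d ∧ apolar G f = 0}) :
    (Ideal.span {q : MvPolynomial (Fin d) K |
        q ∈ RingHom.ker (aeval h : MvPolynomial (Fin d) K →ₐ[K] MvPolynomial (Fin 2) K)
        ∧ q.IsHomogeneous 2}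
      = Ideal.span {q : MvPolynomial (Fin d) K |
          q ∈ Ideal.span {q' : MvPolynomial (Fin d) K |
            q' ∈ RingHom.ker (aeval h : MvPolynomial (Fin d) K →ₐ[K] MvPolynomial (Fin 2) K)
            ∧ q'.IsHomogeneous 2}
          ∧ q.IsHomogeneous 2 ∧ rankLE 4 q})
    ∧ ¬ ∃ S : Set (MvPolynomial (Fin d) K),
        (∀ q ∈ S, q.IsHomogeneous 2 ∧ rankLE 3 q) ∧
        Ideal.span S = Ideal.span {q : MvPolynomial (Fin d) K |
          q ∈ RingHom.ker (aeval h : MvPolynomial (Fin d) K →ₐ[K] MvPolynomial (Fin 2) K)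
          ∧ q.IsHomogeneous 2} := by
  obtain ⟨n, rfl⟩ : ∃ n, d = n + 3 := ⟨d - 3, by omega⟩
  have hn : 2 ≤ n := by omega
  obtain ⟨g0, hg0, hg3, hgf, ℓ, hℓ0, hℓ1, hℓg⟩ := hex3
  obtain ⟨P, hP⟩ : ∃ P : Fin 2 → K, eval P g0 ≠ 0 := by
    by_contra hcon
    push Not at hcon
    exact hg0 (MvPolynomial.funext fun v => by rw [hcon v, map_zero])
  obtain ⟨a, ha⟩ := lin_form hℓ1
  have hPℓ : eval P ℓ ≠ 0 := by
    obtain ⟨r, hr⟩ := hℓg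
    intro h0
    apply hP
    rw [hr, map_mul, map_pow, h0]; simp
  have hPe : eval P ℓ = a 0 * P 0 + a 1 * P 1 := by rw [ha]; simp
  obtain ⟨D, η, hDdeg, hηhom, hDη, hDinj, hηcoeff, hDX⟩ := dehom P ![-a 1, a 0] (by
    rw [hPe] at hPℓ
    simp only [Matrix.cons_val_zero, Matrix.cons_val_one]
    intro h0; apply hPℓ; linear_combination h0)
  have hDC : ∀ r, D (C r) = Polynomial.C r := fun r => by
    rw [← algebraMap_eq, AlgHom.commutes, Polynomial.algebraMap_eq]
  have hDℓ : D ℓ = Polynomial.C (eval P ℓ) * Polynomial.X := by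
    conv_lhs => rw [ha]
    rw [hPe, map_add, map_mul, map_mul, hDX, hDX, hDC, hDC]
    simp only [Matrix.cons_val_zero, Matrix.cons_val_one, Polynomial.C_add, Polynomial.C_mul,
      Polynomial.C_neg]
    ring
  have hηD : ∀ m F, F.IsHomogeneous m → η m (D F) = F := by
    intro m F hF
    have := hDinj m (η m (D F) - F) ((hηhom _ _).sub hF) (by
      rw [map_sub, hDη m _ (hDdeg m F hF), sub_self])
    exact sub_eq_zero.1 this
  have hmem : ∀ i, (h i).IsHomogeneous (n + 3) ∧ apolar (h i) f = 0 := by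
    intro i
    have : h i ∈ (Submodule.span K (Set.range h) : Set (MvPolynomial (Fin 2) K)) :=
      Submodule.subset_span ⟨i, rfl⟩
    rw [hspan] at this
    exact this
  have hspanhom : ∀ F ∈ Submodule.span K (Set.range h), F.IsHomogeneous (n + 3) := by
    intro F hF
    have : F ∈ (Submodule.span K (Set.range h) : Set (MvPolynomial (Fin 2) K)) := hF
    rw [hspan] at this
    exact this.1
  set p : Fin (n + 3) → Polynomial K := fun i => D (h i) with hpdef
  have hp : LinearIndependent K p := by
    have := hind.map (f := D.toLinearMap) (by
      rw [Submodule.disjoint_def]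
      intro F hF hk
      exact hDinj _ F (hspanhom F hF) hk)
    exact this
  set lam : Polynomial K →ₗ[K] K := Lam f ∘ₗ η (n + 3) with hlam
  have hlamD : ∀ F, F.IsHomogeneous (n + 3) → lam (D F) = Lam f F := by
    intro F hF
    rw [hlam, LinearMap.comp_apply, hηD _ _ hF]
  set c := eval P g0 with hc
  set g1 : MvPolynomial (Fin 2) K := C c⁻¹ * g0 with hg1
  have hg1h : g1.IsHomogeneous 3 := hg3.C_mul _
  set G := D g1 with hGdef
  have hG3 : G.coeff 3 = 1 := by
    rw [← hηcoeff 3 G, hGdef, hηD 3 _ hg1h, hg1, map_mul, eval_C, ← hc, inv_mul_cancel₀ hP]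
  have hGle : G.natDegree ≤ 3 := hDdeg 3 _ hg1h
  have hGd : G.natDegree = 3 :=
    le_antisymm hGle (Polynomial.le_natDegree_of_ne_zero (by rw [hG3]; exact one_ne_zero))
  have hX : Polynomial.X ^ 2 ∣ G := by
    obtain ⟨r, hr⟩ := hℓg
    refine ⟨Polynomial.C c⁻¹ * Polynomial.C (eval P ℓ) ^ 2 * D r, ?_⟩
    rw [hGdef, hg1, hr, map_mul, map_mul, map_pow, hDC, hDℓ]
    ring
  obtain ⟨b, hGb⟩ : ∃ b, G = Polynomial.X ^ 2 * (Polynomial.X - Polynomial.C b) := by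
    obtain ⟨R, hR⟩ := hX
    have hR1 : R.coeff 1 = 1 := by
      rw [← hG3, hR, mul_comm, Polynomial.coeff_mul_X_pow R 2 1]
    have hRd : R.natDegree ≤ 1 := by
      have hR0 : R ≠ 0 := by rintro rfl; simp at hR1
      have := congrArg Polynomial.natDegree hR
      rw [Polynomial.natDegree_mul (by simp) hR0, hGd, Polynomial.natDegree_X_pow] at this
      omega
    refine ⟨-R.coeff 0, ?_⟩
    rw [hR, Polynomial.eq_X_add_C_of_natDegree_le_one hRd, hR1]
    simp
  obtain ⟨g, hgd, hcop, hW⟩ := middle (by omega) lam p hp (by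
      intro A hA hA0
      have hmemA : η (n + 3) A ∈ (Submodule.span K (Set.range h) : Set (MvPolynomial (Fin 2) K)) := by
        rw [hspan]
        refine ⟨hηhom _ _, Lam_zero_apolar hfd (hηhom _ _) (k := 0) rfl ?_⟩
        intro N hN
        obtain ⟨r, rfl⟩ : ∃ r, N = C r := by
          refine ⟨N.coeff 0, ?_⟩
          exact totalDegree_eq_zero_iff_eq_C.1 (Nat.le_zero.1 hN.totalDegree_le)
        rw [mul_comm, ← smul_eq_C_mul, map_smul]
        rw [hlam, LinearMap.comp_apply] at hA0
        rw [hA0, smul_zero]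
      have := Submodule.mem_map_of_mem (f := D.toLinearMap) hmemA
      rw [Submodule.map_span, ← Set.range_comp] at this
      have h2 : D.toLinearMap (η (n + 3) A) = A := hDη _ _ hA
      rw [h2] at this
      exact this) G hGd (by
      intro H hH
      have : G * H = D (g1 * η n H) := by rw [map_mul, hDη n H hH]
      rw [this, hlamD _ (by rw [add_comm n 3]; exact hg1h.mul (hηhom n H)), hg1]
      rw [mul_comm (C c⁻¹) g0, mul_assoc]
      exact apolar_zero_Lam hgf _) (by
      intro A hA hH
      have h0 : η 2 A = 0 := by
        refine hno2 _ (hηhom _ _) (Lam_zero_apolar hfd (hηhom _ _) (k := n + 1) (by omega) ?_)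
        intro N hN
        have := hH (D N) (hDdeg _ _ hN)
        rw [← hDη 2 A hA, ← map_mul, hlamD _ (by
          have := (hηhom 2 A).mul hN
          rwa [show 2 + (n + 1) = n + 3 by omega] at this)] at this
        exact this
      rw [← hDη 2 A hA, h0, map_zero])
  have hDq : ∀ q : MvPolynomial (Fin (n + 3)) K, D (aeval h q) = aeval p q := by
    intro q
    rw [← AlgHom.comp_apply, comp_aeval]
  have hiff : ∀ q : MvPolynomial (Fin (n + 3)) K, q.IsHomogeneous 2 → aeval p q = 0 → aeval h q = 0 := by
    intro q hq h0
    have := hq.aeval h (fun i => (hmem i).1)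
    exact hDinj _ _ this (by rw [hDq, h0])
  constructor
  · apply le_antisymm
    · rw [Ideal.span_le]
      rintro q ⟨hqk, hq2⟩
      have hqk' : aeval h q = 0 := hqk
      have := core_four hn p hp G g b hGb hcop hgd hW q hq2 (by rw [← hDq, hqk', map_zero])
      refine Ideal.span_mono ?_ this
      rintro q' ⟨h1, h2, h3⟩
      exact ⟨Ideal.subset_span ⟨hiff q' h1 h2, h1⟩, h1, h3⟩
    · rw [Ideal.span_le]
      rintro q ⟨hq, -, -⟩
      exact hq
  · rintro ⟨S, hS, hSeq⟩
    refine core_not_three (by omega) p hp G g hGd hX hcop hW S ?_ ?_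
    · intro q hq
      refine ⟨(hS q hq).2, ?_⟩
      have hqJ : q ∈ Ideal.span S := Ideal.subset_span hq
      rw [hSeq] at hqJ
      have hle : Ideal.span {q : MvPolynomial (Fin (n + 3)) K |
          q ∈ RingHom.ker (aeval h : MvPolynomial (Fin (n + 3)) K →ₐ[K] MvPolynomial (Fin 2) K)
          ∧ q.IsHomogeneous 2} ≤
          RingHom.ker (aeval h : MvPolynomial (Fin (n + 3)) K →ₐ[K] MvPolynomial (Fin 2) K) :=
        Ideal.span_le.2 fun q hq => hq.1
      have h0 : aeval h q = 0 := hle hqJ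
      rw [← hDq, h0, map_zero]
    · intro q hq h0
      rw [hSeq]
      exact Ideal.subset_span ⟨hiff q hq h0, hq⟩
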